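/- arXiv:1505.06183 — 2 statements merged into one kernel-verified Lean document; each statement's English description precedes it below -/
import Mathlib

section
/- For every i, j ∈ {1,…,n}: Σ_{p,q=1}^n ∫_{S^{n-1}} x_i H_{pq}(x̄) ∂_j H_{pq}(x̄) dS = (1/(n+2)) Σ_{p,q=1}^n ∫_{S^{n-1}} ∂_i H_{pq}(x̄) ∂_j H_{pq}(x̄) dS = (1/(n+2)) Σ_{k,p,q=1}^n ∫_{S^{n-1}} x_i ∂_k H_{pq}(x̄) ∂_{jk} H_{pq}(x̄) dS = (|S^{n-1}|/(n(n+2))) W̃_{ij}; moreover Σ_{p,q=1}^n ∫_{S^{n-1}} H_{pq}(x̄) ∂_{ij} H_{pq}(x̄) dS = 0. -/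
open MeasureTheory Real Filter Topology

noncomputable section

/-- The tensor `H_{ij}(x̄) = Σ_{k,l} W_{ikjl} x^k x^l`. -/
def Hten (n : ℕ) (W4 : Fin n → Fin n → Fin n → Fin n → ℝ) (i j : Fin n)
    (x : EuclideanSpace ℝ (Fin n)) : ℝ :=
  ∑ k, ∑ l, W4 i k j l * x k * x l

/-- The squared tensor norm `|W|² = Σ (W_{ikjl} + W_{iljk})²`. -/
def normWsq (n : ℕ) (W4 : Fin n → Fin n → Fin n → Fin n → ℝ) : ℝ :=
  ∑ i, ∑ j, ∑ k, ∑ l, (W4 i k j l + W4 i l j k) ^ 2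

/-- The symmetric two-tensor `W̃_{ij} = Σ_{k,p,q}(W_{ikpq}+W_{kqip})(W_{jkpq}+W_{kqjp})`. -/
def Wtil (n : ℕ) (W4 : Fin n → Fin n → Fin n → Fin n → ℝ) (i j : Fin n) : ℝ :=
  ∑ k, ∑ p, ∑ q, (W4 i k p q + W4 k q i p) * (W4 j k p q + W4 k q j p)

/-- The partial derivative `∂_k f`. -/
def pd (n : ℕ) (k : Fin n) (f : EuclideanSpace ℝ (Fin n) → ℝ) :
    EuclideanSpace ℝ (Fin n) → ℝ :=
  fun x => fderiv ℝ f x (EuclideanSpace.single k 1)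

/-- The Euclidean Laplacian `Δf = Σ_k ∂_k∂_k f`. -/
def lapl (n : ℕ) (f : EuclideanSpace ℝ (Fin n) → ℝ) :
    EuclideanSpace ℝ (Fin n) → ℝ :=
  fun x => ∑ k, pd n k (pd n k f) x

/-- The tensor `h̄_{ij}(x̄) = f(|x̄|²) H_{ij}(x̄)`. -/
def hbar (n : ℕ) (W4 : Fin n → Fin n → Fin n → Fin n → ℝ) (f : Polynomial ℝ)
    (i j : Fin n) (x : EuclideanSpace ℝ (Fin n)) : ℝ :=
  Polynomial.eval (‖x‖ ^ 2) f * Hten n W4 i j x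

theorem hausdorffMeasure_sphere_lt_top {E : Type*} [NormedAddCommGroup E]
    [InnerProductSpace ℝ E] [MeasurableSpace E] [BorelSpace E] (m : ℕ)
    [hm : Fact (Module.finrank ℝ E = m + 1)] :
    μH[(m : ℝ)] (Metric.sphere (0 : E) 1) < ⊤ := by
  have : FiniteDimensional ℝ E := .of_fact_finrank_eq_succ m
  refine (isCompact_sphere (0 : E) 1).measure_lt_top_of_nhdsWithin fun x hx => ?_
  have hx1 : ‖-x‖ = 1 := by simpa using hx
  set V := (Submodule.span ℝ {-x})ᗮ
  have hV : Module.finrank ℝ V = m :=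
    Submodule.finrank_orthogonal_span_singleton (by rw [← norm_ne_zero_iff, hx1]; simp)
  have hloc : LocallyLipschitzOn (Metric.closedBall (0 : V) 1)
      (fun w : V => stereoInvFunAux (-x) (w : E)) :=
    ((contDiff_stereoInvFunAux.comp V.subtypeL.contDiff).locallyLipschitz).locallyLipschitzOn
  obtain ⟨K, hK⟩ := hloc.exists_lipschitzOnWith_of_compact (isCompact_closedBall 0 1)
  have hpole : inner ℝ (-x) x ≠ 1 := by
    simp [← norm_neg x, hx1]
    norm_num
  have hcont : ContinuousAt (stereoToFun (-x)) x :=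
    continuousOn_stereoToFun.continuousAt
      ((isOpen_ne_fun (innerSL ℝ (-x)).continuous continuous_const).mem_nhds hpole)
  have hzero : stereoToFun (-x) x = 0 := by
    exact stereographic_neg_apply (⟨x, hx⟩ : Metric.sphere (0 : E) 1)
  refine ⟨(fun w : V => stereoInvFunAux (-x) (w : E)) '' Metric.closedBall 0 1, ?_, ?_⟩
  · rw [mem_nhdsWithin_iff_exists_mem_nhds_inter]
    refine ⟨{y | inner ℝ (-x) y ≠ 1} ∩ stereoToFun (-x) ⁻¹' Metric.closedBall 0 1,
      inter_mem ((isOpen_ne_fun (innerSL ℝ (-x)).continuous continuous_const).mem_nhds hpole)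
      (hcont.preimage_mem_nhds (by
        rw [hzero]; exact Metric.closedBall_mem_nhds _ one_pos)), ?_⟩
    rintro y ⟨⟨hy1, hy2⟩, hy3⟩
    refine ⟨stereoToFun (-x) y, hy2, ?_⟩
    have := stereo_left_inv hx1 (x := ⟨y, hy3⟩) (by
      rintro (rfl : y = -x)
      exact hy1 (by rw [real_inner_self_eq_norm_sq, hx1]; norm_num))
    exact congrArg Subtype.val this
  · refine (hK.hausdorffMeasure_image_le (Nat.cast_nonneg m)).trans_lt ?_
    have h2 : μH[(m : ℝ)] (Metric.closedBall (0 : V) 1) < ⊤ := by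
      rw [← hV]
      exact (isCompact_closedBall (0 : V) 1).measure_lt_top
    exact ENNReal.mul_lt_top (ENNReal.rpow_lt_top_of_nonneg (Nat.cast_nonneg m) (by simp)) h2

theorem hausdorffMeasure_euclidean_sphere_lt_top {n : ℕ} (hn : 2 ≤ n) :
    μH[(n : ℝ) - 1] (Metric.sphere (0 : EuclideanSpace ℝ (Fin n)) 1) < ⊤ := by
  obtain ⟨m, rfl⟩ : ∃ m, n = m + 1 := ⟨n - 1, by lia⟩
  have : Fact (Module.finrank ℝ (EuclideanSpace ℝ (Fin (m + 1))) = m + 1) :=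
    ⟨finrank_euclideanSpace_fin⟩
  simpa using hausdorffMeasure_sphere_lt_top (E := EuclideanSpace ℝ (Fin (m + 1))) m

section SphereMoments

variable {E : Type*} [NormedAddCommGroup E] [InnerProductSpace ℝ E] [MeasurableSpace E]
  [BorelSpace E]

theorem setIntegral_sphere_comp_linearIsometryEquiv (d : ℝ) (e : E ≃ₗᵢ[ℝ] E) (f : E → ℝ) :
    ∫ x in Metric.sphere (0 : E) 1, f (e x) ∂μH[d] =
      ∫ x in Metric.sphere (0 : E) 1, f x ∂μH[d] := by
  have h := (e.toIsometryEquiv.measurePreserving_hausdorffMeasure d).setIntegral_preimage_emb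
    e.toHomeomorph.measurableEmbedding f (Metric.sphere 0 1)
  have hs : e.toIsometryEquiv ⁻¹' Metric.sphere (0 : E) 1 = Metric.sphere 0 1 := by
    ext x
    simp
  rwa [hs] at h

theorem setIntegral_sphere_comp_inner_eq_of_norm_eq (d : ℝ) (g : ℝ → ℝ) {u v : E}
    (h : ‖u‖ = ‖v‖) :
    ∫ x in Metric.sphere (0 : E) 1, g (inner ℝ u x) ∂μH[d] =
      ∫ x in Metric.sphere (0 : E) 1, g (inner ℝ v x) ∂μH[d] := by
  set R := (Submodule.span ℝ {u - v})ᗮ.reflection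
  rw [← setIntegral_sphere_comp_linearIsometryEquiv d R fun x => g (inner ℝ v x)]
  have hR : v = R u := (Submodule.reflection_sub h).symm
  simp_rw [hR, R.inner_map_map]

theorem exists_setIntegral_sphere_inner_pow_eq [Nontrivial E] (d : ℝ) (k : ℕ) :
    ∃ c, ∀ u : E, ∫ x in Metric.sphere (0 : E) 1, inner ℝ u x ^ k ∂μH[d] = ‖u‖ ^ k * c := by
  obtain ⟨e, he⟩ := exists_norm_eq E zero_le_one
  refine ⟨∫ x in Metric.sphere (0 : E) 1, inner ℝ e x ^ k ∂μH[d], fun u => ?_⟩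
  rw [setIntegral_sphere_comp_inner_eq_of_norm_eq d (· ^ k) (v := ‖u‖ • e)
    (by simp [norm_smul, he]), ← integral_const_mul]
  simp_rw [real_inner_smul_left, mul_pow]

variable [FiniteDimensional ℝ E] {d : ℝ} (hd : μH[d] (Metric.sphere (0 : E) 1) < ⊤)
include hd

theorem Continuous.integrableOn_sphere_hausdorffMeasure {f : E → ℝ} (hf : Continuous f) :
    IntegrableOn f (Metric.sphere 0 1) μH[d] := by
  obtain ⟨C, hC⟩ := (isCompact_sphere (0 : E) 1).exists_bound_of_continuousOn hf.continuousOn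
  exact .of_bound hd hf.aestronglyMeasurable C
    (ae_restrict_of_forall_mem Metric.isClosed_sphere.measurableSet hC)

theorem setIntegral_sphere_mul_sum_inner_sq {ι : Type*} [Fintype ι] (b : OrthonormalBasis ι ℝ E)
    {f : E → ℝ} (hf : Continuous f) :
    ∑ i, ∫ x in Metric.sphere (0 : E) 1, f x * inner ℝ (b i) x ^ 2 ∂μH[d] =
      ∫ x in Metric.sphere (0 : E) 1, f x ∂μH[d] := by
  rw [← integral_finsetSum _ fun i _ =>
    Continuous.integrableOn_sphere_hausdorffMeasure hd (by fun_prop)]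
  refine setIntegral_congr_fun Metric.isClosed_sphere.measurableSet fun x hx => ?_
  rw [← Finset.mul_sum, b.sum_sq_inner_right, mem_sphere_zero_iff_norm.1 hx]
  simp

variable [Nontrivial E]

theorem exists_setIntegral_sphere_inner_mul_inner_eq :
    ∃ c, ∀ u v : E, ∫ x in Metric.sphere (0 : E) 1, inner ℝ u x * inner ℝ v x ∂μH[d] =
      inner ℝ u v * c := by
  obtain ⟨c, hc⟩ := exists_setIntegral_sphere_inner_pow_eq (E := E) d 2
  refine ⟨c, fun u v => ?_⟩
  have hint (w : E) : Integrable (fun x => inner ℝ w x ^ 2)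
      (μH[d].restrict (Metric.sphere (0 : E) 1)) :=
    Continuous.integrableOn_sphere_hausdorffMeasure hd (by fun_prop)
  have hpol (x : E) : inner ℝ u x * inner ℝ v x =
      4⁻¹ * (inner ℝ (u + v) x ^ 2 - inner ℝ (u - v) x ^ 2) := by
    simp only [inner_add_left, inner_sub_left]
    ring
  simp_rw [hpol]
  rw [integral_const_mul, integral_sub (hint _) (hint _)]
  simp only [hc, norm_add_sq_real, norm_sub_sq_real]
  ring

theorem exists_setIntegral_sphere_inner_mul_four_eq :
    ∃ c, ∀ u v w z : E, ∫ x in Metric.sphere (0 : E) 1,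
        inner ℝ u x * inner ℝ v x * inner ℝ w x * inner ℝ z x ∂μH[d] =
      (inner ℝ u v * inner ℝ w z + inner ℝ u w * inner ℝ v z + inner ℝ u z * inner ℝ v w) *
        c := by
  obtain ⟨c, hc⟩ := exists_setIntegral_sphere_inner_pow_eq (E := E) d 4
  refine ⟨c / 3, fun u v w z => ?_⟩
  have hint (w : E) : Integrable (fun x => inner ℝ w x ^ 4)
      (μH[d].restrict (Metric.sphere (0 : E) 1)) :=
    Continuous.integrableOn_sphere_hausdorffMeasure hd (by fun_prop)
  have hpol (x : E) : inner ℝ u x * inner ℝ v x * inner ℝ w x * inner ℝ z x =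
      192⁻¹ * (inner ℝ (u + v + w + z) x ^ 4 - inner ℝ (u + v + w - z) x ^ 4
        - inner ℝ (u + v - w + z) x ^ 4 + inner ℝ (u + v - w - z) x ^ 4
        - inner ℝ (u - v + w + z) x ^ 4 + inner ℝ (u - v + w - z) x ^ 4
        + inner ℝ (u - v - w + z) x ^ 4 - inner ℝ (u - v - w - z) x ^ 4) := by
    simp only [inner_add_left, inner_sub_left]
    ring
  simp_rw [hpol]
  have hnorm (y : E) : ‖y‖ ^ 4 = inner ℝ y y ^ 2 := by
    rw [real_inner_self_eq_norm_sq]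
    ring
  rw [integral_const_mul, integral_sub (by fun_prop) (hint _), integral_add (by fun_prop) (hint _),
    integral_add (by fun_prop) (hint _), integral_sub (by fun_prop) (hint _),
    integral_add (by fun_prop) (hint _), integral_sub (by fun_prop) (hint _),
    integral_sub (hint _) (hint _)]
  simp only [hc, hnorm]
  simp only [inner_add_left, inner_sub_left,
    inner_add_right, inner_sub_right, real_inner_comm u, real_inner_comm v w,
    real_inner_comm v z, real_inner_comm w z]
  ring

theorem setIntegral_sphere_inner_mul_inner (u v : E) :
    ∫ x in Metric.sphere (0 : E) 1, inner ℝ u x * inner ℝ v x ∂μH[d] =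
      (μH[d] (Metric.sphere (0 : E) 1)).toReal / Module.finrank ℝ E * inner ℝ u v := by
  obtain ⟨c, hc⟩ := exists_setIntegral_sphere_inner_mul_inner_eq hd
  have hsum := setIntegral_sphere_mul_sum_inner_sq hd (stdOrthonormalBasis ℝ E)
    (continuous_const (y := (1 : ℝ)))
  have hpos : (0 : ℝ) < Module.finrank ℝ E := by exact_mod_cast Module.finrank_pos
  simp only [one_mul, pow_two, hc,
    real_inner_self_eq_norm_sq, OrthonormalBasis.norm_eq_one, Finset.sum_const, Finset.card_univ,
    Fintype.card_fin, nsmul_eq_mul, setIntegral_const, smul_eq_mul, mul_one, measureReal_def]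
    at hsum
  rw [hc, ← hsum]
  field_simp

theorem setIntegral_sphere_inner_mul_four (u v w z : E) :
    ∫ x in Metric.sphere (0 : E) 1,
        inner ℝ u x * inner ℝ v x * inner ℝ w x * inner ℝ z x ∂μH[d] =
      (μH[d] (Metric.sphere (0 : E) 1)).toReal /
          (Module.finrank ℝ E * (Module.finrank ℝ E + 2)) *
        (inner ℝ u v * inner ℝ w z + inner ℝ u w * inner ℝ v z + inner ℝ u z * inner ℝ v w) := by
  obtain ⟨e, he⟩ := exists_norm_eq E zero_le_one
  obtain ⟨c, hc⟩ := exists_setIntegral_sphere_inner_mul_four_eq hd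
  have hpos : (0 : ℝ) < Module.finrank ℝ E := by exact_mod_cast Module.finrank_pos
  set b := stdOrthonormalBasis ℝ E
  have hsum := setIntegral_sphere_mul_sum_inner_sq hd b
    (f := fun x => inner ℝ e x * inner ℝ e x) (by fun_prop)
  have hb : ∑ i, inner ℝ e (b i) * inner ℝ e (b i) = 1 := by
    simpa [he, pow_two] using b.sum_sq_inner_left e
  rw [setIntegral_sphere_inner_mul_inner hd] at hsum
  simp only [pow_two, ← mul_assoc, hc] at hsum
  simp only [← Finset.sum_mul, Finset.sum_add_distrib, hb, real_inner_self_eq_norm_sq,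
    OrthonormalBasis.norm_eq_one, he, Finset.sum_const, Finset.card_univ,
    Fintype.card_fin, nsmul_eq_mul, one_pow, mul_one] at hsum
  rw [hc, ← div_div, ← hsum]
  field_simp
  ring

end SphereMoments

section WeylQuadraticForm

variable {n : ℕ}

theorem setIntegral_sphere_euclidean_inner_mul_inner (hn : 2 ≤ n)
    (u v : EuclideanSpace ℝ (Fin n)) :
    ∫ x in Metric.sphere (0 : EuclideanSpace ℝ (Fin n)) 1,
        inner ℝ u x * inner ℝ v x ∂μH[(n : ℝ) - 1] =
      (μH[(n : ℝ) - 1] (Metric.sphere (0 : EuclideanSpace ℝ (Fin n)) 1)).toReal / n *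
        inner ℝ u v := by
  have : Nonempty (Fin n) := ⟨⟨0, by lia⟩⟩
  simpa using setIntegral_sphere_inner_mul_inner (hausdorffMeasure_euclidean_sphere_lt_top hn) u v

theorem pd_inner (k : Fin n) (v : EuclideanSpace ℝ (Fin n)) :
    pd n k (fun x => inner ℝ v x) = fun _ => v k := by
  ext x
  have h : HasFDerivAt (fun x => inner ℝ v x) (innerSL ℝ v) x := (innerSL ℝ v).hasFDerivAt
  simp [pd, h.fderiv, EuclideanSpace.inner_single_right]

/-- The coefficient vector of the linear form `∂_j H_{pq}`. -/
def HtenGrad (W4 : Fin n → Fin n → Fin n → Fin n → ℝ) (p q j : Fin n) :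
    EuclideanSpace ℝ (Fin n) :=
  WithLp.toLp 2 fun l => W4 p j q l + W4 p l q j

theorem HtenGrad_comm (W4 : Fin n → Fin n → Fin n → Fin n → ℝ) (p q j k : Fin n) :
    HtenGrad W4 p q j k = HtenGrad W4 p q k j := by
  simp [HtenGrad, add_comm]

theorem pd_Hten (W4 : Fin n → Fin n → Fin n → Fin n → ℝ) (p q j : Fin n) :
    pd n j (Hten n W4 p q) = fun x => inner ℝ (HtenGrad W4 p q j) x := by
  ext x
  have hproj (k : Fin n) : HasFDerivAt (fun x : EuclideanSpace ℝ (Fin n) => x k)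
      (EuclideanSpace.proj k : EuclideanSpace ℝ (Fin n) →L[ℝ] ℝ) x :=
    (EuclideanSpace.proj k : EuclideanSpace ℝ (Fin n) →L[ℝ] ℝ).hasFDerivAt
  have h : HasFDerivAt (Hten n W4 p q) _ x :=
    HasFDerivAt.fun_sum fun k _ => HasFDerivAt.fun_sum fun l _ =>
      ((hproj k).const_mul (W4 p k q l)).mul (hproj l)
  rw [pd, h.fderiv]
  simp [PiLp.inner_apply, HtenGrad, Finset.sum_add_distrib, mul_comm, add_mul]
  rw [add_comm]

theorem Hten_eq_sum_inner (W4 : Fin n → Fin n → Fin n → Fin n → ℝ) (p q : Fin n)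
    (x : EuclideanSpace ℝ (Fin n)) :
    Hten n W4 p q x = ∑ k, ∑ l, W4 p k q l *
      (inner ℝ (EuclideanSpace.single k 1) x * inner ℝ (EuclideanSpace.single l 1) x) := by
  simp [Hten, EuclideanSpace.inner_single_left, mul_assoc]

theorem continuous_Hten (W4 : Fin n → Fin n → Fin n → Fin n → ℝ) (p q : Fin n) :
    Continuous (Hten n W4 p q) := by
  unfold Hten
  fun_prop

theorem setIntegral_sphere_Hten (hn : 2 ≤ n) {W4 : Fin n → Fin n → Fin n → Fin n → ℝ}
    {p q : Fin n} (htr : ∑ k, W4 p k q k = 0) :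
    ∫ x in Metric.sphere (0 : EuclideanSpace ℝ (Fin n)) 1,
      Hten n W4 p q x ∂μH[(n : ℝ) - 1] = 0 := by
  have hd := hausdorffMeasure_euclidean_sphere_lt_top hn
  simp_rw [Hten_eq_sum_inner]
  rw [integral_finsetSum _ fun k _ =>
    Continuous.integrableOn_sphere_hausdorffMeasure hd (by fun_prop)]
  simp_rw [fun k => integral_finsetSum (μ := (μH[(n : ℝ) - 1]).restrict
    (Metric.sphere (0 : EuclideanSpace ℝ (Fin n)) 1)) Finset.univ
    (f := fun l x => W4 p k q l * (inner ℝ (EuclideanSpace.single k 1) x *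
      inner ℝ (EuclideanSpace.single l 1) x)) fun l _ =>
    Continuous.integrableOn_sphere_hausdorffMeasure hd (by fun_prop), integral_const_mul,
    setIntegral_sphere_euclidean_inner_mul_inner hn]
  simp [EuclideanSpace.inner_single_left, ← Finset.sum_mul, htr]

theorem setIntegral_sphere_coord_mul_Hten_mul_inner (hn : 2 ≤ n)
    {W4 : Fin n → Fin n → Fin n → Fin n → ℝ} {p q : Fin n} (htr : ∑ k, W4 p k q k = 0)
    (i : Fin n) (v : EuclideanSpace ℝ (Fin n)) :
    ∫ x in Metric.sphere (0 : EuclideanSpace ℝ (Fin n)) 1,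
        x i * Hten n W4 p q x * inner ℝ v x ∂μH[(n : ℝ) - 1] =
      (μH[(n : ℝ) - 1] (Metric.sphere (0 : EuclideanSpace ℝ (Fin n)) 1)).toReal /
        (n * (n + 2)) * inner ℝ (HtenGrad W4 p q i) v := by
  have hd := hausdorffMeasure_euclidean_sphere_lt_top hn
  have : Nonempty (Fin n) := ⟨⟨0, by lia⟩⟩
  have hexp (x : EuclideanSpace ℝ (Fin n)) : x i * Hten n W4 p q x * inner ℝ v x =
      ∑ k, ∑ l, W4 p k q l * (inner ℝ (EuclideanSpace.single i 1) x *
        inner ℝ (EuclideanSpace.single k 1) x * inner ℝ (EuclideanSpace.single l 1) x *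
          inner ℝ v x) := by
    rw [Hten_eq_sum_inner, Finset.mul_sum, Finset.sum_mul]
    simp_rw [Finset.mul_sum, Finset.sum_mul]
    simp only [EuclideanSpace.inner_single_left, map_one, one_mul]
    exact Finset.sum_congr rfl fun k _ => Finset.sum_congr rfl fun l _ => by ring
  simp_rw [hexp]
  rw [integral_finsetSum _ fun k _ =>
    Continuous.integrableOn_sphere_hausdorffMeasure hd (by fun_prop)]
  simp_rw [fun k => integral_finsetSum (μ := (μH[(n : ℝ) - 1]).restrict
    (Metric.sphere (0 : EuclideanSpace ℝ (Fin n)) 1)) Finset.univ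
    (f := fun l x => W4 p k q l * (inner ℝ (EuclideanSpace.single i 1) x *
        inner ℝ (EuclideanSpace.single k 1) x * inner ℝ (EuclideanSpace.single l 1) x *
          inner ℝ v x)) fun l _ =>
    Continuous.integrableOn_sphere_hausdorffMeasure hd (by fun_prop), integral_const_mul,
    setIntegral_sphere_inner_mul_four hd, mul_left_comm (W4 _ _ _ _), ← Finset.mul_sum]
  rw [finrank_euclideanSpace_fin]
  congr 1
  simp only [mul_add, Finset.sum_add_distrib]
  have hdiag : ∑ k, ∑ l, W4 p k q l * (inner ℝ (EuclideanSpace.single i (1 : ℝ)) v *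
      inner ℝ (EuclideanSpace.single k (1 : ℝ)) (EuclideanSpace.single l (1 : ℝ))) = 0 := by
    simp [EuclideanSpace.inner_single_left, ← Finset.sum_mul, htr]
  rw [hdiag, add_zero]
  simp [PiLp.inner_apply, HtenGrad, Finset.sum_add_distrib, mul_comm, add_mul]

theorem sum_inner_HtenGrad {W4 : Fin n → Fin n → Fin n → Fin n → ℝ}
    (hanti1 : ∀ i j k l, W4 i j k l = -W4 j i k l)
    (hanti2 : ∀ i j k l, W4 i j k l = -W4 i j l k) (i j : Fin n) :
    ∑ p, ∑ q, inner ℝ (HtenGrad W4 p q i) (HtenGrad W4 p q j) = Wtil n W4 i j := by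
  simp only [PiLp.inner_apply, HtenGrad, Wtil]
  refine Finset.sum_congr rfl fun k _ => Finset.sum_congr rfl fun p _ =>
    Finset.sum_congr rfl fun q _ => ?_
  rw [hanti1 i k p q, hanti1 j k p q, hanti2 k q i p, hanti2 k q j p]
  simp
  ring

end WeylQuadraticForm

theorem stmt_12 (n : ℕ) (hn : 2 ≤ n) (W4 : Fin n → Fin n → Fin n → Fin n → ℝ)
    (hanti1 : ∀ i j k l, W4 i j k l = -W4 j i k l)
    (hanti2 : ∀ i j k l, W4 i j k l = -W4 i j l k)
    (hsymm : ∀ i j k l, W4 i j k l = W4 k l i j)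
    (hbianchi : ∀ i j k l, W4 i j k l + W4 i k l j + W4 i l j k = 0)
    (htrace : ∀ j k, ∑ i, W4 i j i k = 0) :
    ∀ i j : Fin n,
      (∑ p, ∑ q, ∫ x in Metric.sphere (0 : EuclideanSpace ℝ (Fin n)) 1,
          x i * Hten n W4 p q x * pd n j (Hten n W4 p q) x ∂μH[(n : ℝ) - 1]) =
        (1 / ((n : ℝ) + 2)) *
          ∑ p, ∑ q, ∫ x in Metric.sphere (0 : EuclideanSpace ℝ (Fin n)) 1,
            pd n i (Hten n W4 p q) x * pd n j (Hten n W4 p q) x ∂μH[(n : ℝ) - 1] ∧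
      ((1 / ((n : ℝ) + 2)) *
          ∑ p, ∑ q, ∫ x in Metric.sphere (0 : EuclideanSpace ℝ (Fin n)) 1,
            pd n i (Hten n W4 p q) x * pd n j (Hten n W4 p q) x ∂μH[(n : ℝ) - 1]) =
        (1 / ((n : ℝ) + 2)) *
          ∑ k, ∑ p, ∑ q, ∫ x in Metric.sphere (0 : EuclideanSpace ℝ (Fin n)) 1,
            x i * pd n k (Hten n W4 p q) x * pd n j (pd n k (Hten n W4 p q)) x
              ∂μH[(n : ℝ) - 1] ∧
      ((1 / ((n : ℝ) + 2)) *
          ∑ k, ∑ p, ∑ q, ∫ x in Metric.sphere (0 : EuclideanSpace ℝ (Fin n)) 1,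
            x i * pd n k (Hten n W4 p q) x * pd n j (pd n k (Hten n W4 p q)) x
              ∂μH[(n : ℝ) - 1]) =
        (μH[(n : ℝ) - 1] (Metric.sphere (0 : EuclideanSpace ℝ (Fin n)) 1)).toReal /
          ((n : ℝ) * ((n : ℝ) + 2)) * Wtil n W4 i j ∧
      (∑ p, ∑ q, ∫ x in Metric.sphere (0 : EuclideanSpace ℝ (Fin n)) 1,
          Hten n W4 p q x * pd n i (pd n j (Hten n W4 p q)) x ∂μH[(n : ℝ) - 1]) = 0 := by
  intro i j
  have htr (p q : Fin n) : ∑ k, W4 p k q k = 0 := by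
    rw [← htrace p q]
    refine Finset.sum_congr rfl fun k _ => ?_
    rw [hanti1, hanti2, neg_neg]
  have hn0 : (n : ℝ) ≠ 0 := by
    have : n ≠ 0 := by lia
    exact_mod_cast this
  have hW := sum_inner_HtenGrad hanti1 hanti2 i j
  set S := (μH[(n : ℝ) - 1] (Metric.sphere (0 : EuclideanSpace ℝ (Fin n)) 1)).toReal
  have h1 : (∑ p, ∑ q, ∫ x in Metric.sphere (0 : EuclideanSpace ℝ (Fin n)) 1,
      x i * Hten n W4 p q x * pd n j (Hten n W4 p q) x ∂μH[(n : ℝ) - 1]) =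
        S / (n * (n + 2)) * Wtil n W4 i j := by
    simp_rw [pd_Hten, fun p q => setIntegral_sphere_coord_mul_Hten_mul_inner hn (htr p q) i,
      ← Finset.mul_sum, hW, S]
  have h2 : (∑ p, ∑ q, ∫ x in Metric.sphere (0 : EuclideanSpace ℝ (Fin n)) 1,
      pd n i (Hten n W4 p q) x * pd n j (Hten n W4 p q) x ∂μH[(n : ℝ) - 1]) =
        S / n * Wtil n W4 i j := by
    simp_rw [pd_Hten, setIntegral_sphere_euclidean_inner_mul_inner hn, ← Finset.mul_sum, hW, S]
  have h3 : (∑ k, ∑ p, ∑ q, ∫ x in Metric.sphere (0 : EuclideanSpace ℝ (Fin n)) 1,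
      x i * pd n k (Hten n W4 p q) x * pd n j (pd n k (Hten n W4 p q)) x ∂μH[(n : ℝ) - 1]) =
        S / n * Wtil n W4 i j := by
    have hterm (k p q : Fin n) : ∫ x in Metric.sphere (0 : EuclideanSpace ℝ (Fin n)) 1,
        x i * pd n k (Hten n W4 p q) x * pd n j (pd n k (Hten n W4 p q)) x ∂μH[(n : ℝ) - 1] =
          S / n * (HtenGrad W4 p q j k * HtenGrad W4 p q i k) := by
      have h := setIntegral_sphere_euclidean_inner_mul_inner hn (EuclideanSpace.single i 1)
        (HtenGrad W4 p q k)
      simp only [EuclideanSpace.inner_single_left, map_one, one_mul] at h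
      simp only [pd_Hten, pd_inner, integral_mul_const, h, S, HtenGrad_comm W4 p q k]
      ring
    simp_rw [hterm, ← Finset.mul_sum, ← hW]
    congr 1
    rw [Finset.sum_comm]
    refine Finset.sum_congr rfl fun p _ => ?_
    rw [Finset.sum_comm]
    simp [PiLp.inner_apply]
  refine ⟨?_, ?_, ?_, ?_⟩
  · rw [h1, h2]
    field_simp
  · rw [h2, h3]
  · rw [h3]
    field_simp
  · simp_rw [pd_Hten, pd_inner, integral_mul_const, fun p q => setIntegral_sphere_Hten hn (htr p q)]
    simp

end
end

section
/- For every integer m with 0 ≤ m ≤ 2d₀ + 1 there exist functions G̃_{1,m},…,G̃_{11,m} : [0,∞) → ℝ (independent of i and j) such that for all i, j ∈ {1,…,n} and all x̄ ∈ ℝⁿ, writing r = |x̄|: Σ_{k,p,q=1}^n Δ^m[∂_{ij}((∂_k h̄_{pq})²)](x̄) = G̃_{1,m}(r) δ_{ij} Σ_{k,p,q}(∂_k H_{pq}(x̄))² + G̃_{2,m}(r) δ_{ij} Σ_{p,q} H_{pq}(x̄)² + G̃_{3,m}(r) δ_{ij} |W|² + G̃_{4,m}(r) Σ_{p,q} [x_i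 H_{pq}(x̄) ∂_j H_{pq}(x̄) + x_j H_{pq}(x̄) ∂_i H_{pq}(x̄)] + G̃_{5,m}(r) Σ_{p,q} ∂_i H_{pq}(x̄) ∂_j H_{pq}(x̄) + G̃_{6,m}(r) Σ_{k,p,q} [x_i ∂_k H_{pq}(x̄) ∂_{jk} H_{pq}(x̄) + x_j ∂_k H_{pq}(x̄) ∂_{ik} H_{pq}(x̄)] + G̃_{7,m}(r) W̃_{ij} + G̃_{8,m}(r) x_i x_j Σ_{k,p,q}(∂_k H_{pq}(x̄))² + G̃_{9,m}(r) x_i x_j Σ_{p,q} H_{pq}(x̄)² + G̃_{10,m}(r) x_i x_j |W|² + G̃_{11,m}(r) Σ_{p,q} H_{pq}(x̄) ∂_{ij} H_{pq}(x̄), where Δ^m denotes the m-fold iterate of the Euclidean Laplacian on ℝⁿ. -/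
open MeasureTheory Real Filter Topology

noncomputable section

section PolynomialCalculus

open MvPolynomial

variable {n : ℕ}

/-- The function on Euclidean space defined by a multivariate polynomial. -/
def polyFun (p : MvPolynomial (Fin n) ℝ) (x : EuclideanSpace ℝ (Fin n)) : ℝ :=
  eval (fun i => x i) p

lemma hasFDerivAt_polyFun (p : MvPolynomial (Fin n) ℝ) (x : EuclideanSpace ℝ (Fin n)) :
    HasFDerivAt (polyFun p)
      (∑ k, polyFun (pderiv k p) x • (EuclideanSpace.proj k : EuclideanSpace ℝ (Fin n) →L[ℝ] ℝ))
      x := by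
  induction p using MvPolynomial.induction_on with
  | C a =>
    have h : polyFun (C a : MvPolynomial (Fin n) ℝ) = fun _ => a := by
      ext y; simp [polyFun]
    rw [h]
    exact (hasFDerivAt_const a x).congr_fderiv (by simp [polyFun])
  | add p q hp hq =>
    have h : polyFun (p + q) = fun y => polyFun p y + polyFun q y := by
      ext y; simp [polyFun]
    rw [h]
    convert! hp.add hq using 1
    simp [polyFun, add_smul, Finset.sum_add_distrib]
  | mul_X p i hp =>
    have h : polyFun (p * X i) = fun y => polyFun p y * y i := by
      ext y; simp [polyFun]
    rw [h]
    have hX : HasFDerivAt (fun y : EuclideanSpace ℝ (Fin n) => y i)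
        (EuclideanSpace.proj i : EuclideanSpace ℝ (Fin n) →L[ℝ] ℝ) x :=
      (EuclideanSpace.proj i : EuclideanSpace ℝ (Fin n) →L[ℝ] ℝ).hasFDerivAt
    convert! hp.mul hX using 1
    ext v
    simp [polyFun, pderiv_X, Pi.single_apply, add_mul, Finset.sum_add_distrib, Finset.mul_sum,
      apply_ite, mul_assoc]

lemma pd_polyFun (k : Fin n) (p : MvPolynomial (Fin n) ℝ) :
    pd n k (polyFun p) = polyFun (pderiv k p) := by
  ext x
  simp [pd, (hasFDerivAt_polyFun p x).fderiv]

/-- The Laplacian on multivariate polynomials. -/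
def polyLap (n : ℕ) : MvPolynomial (Fin n) ℝ →ₗ[ℝ] MvPolynomial (Fin n) ℝ :=
  ∑ k, (pderiv k).toLinearMap ∘ₗ (pderiv k).toLinearMap

lemma polyLap_apply (p : MvPolynomial (Fin n) ℝ) :
    polyLap n p = ∑ k, pderiv k (pderiv k p) := by
  simp [polyLap]

lemma lapl_polyFun (p : MvPolynomial (Fin n) ℝ) :
    lapl n (polyFun p) = polyFun (polyLap n p) := by
  ext x
  simp [lapl, pd_polyFun, polyLap_apply, polyFun]

lemma iterate_lapl_polyFun (m : ℕ) (p : MvPolynomial (Fin n) ℝ) :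
    (lapl n)^[m] (polyFun p) = polyFun ((polyLap n)^[m] p) := by
  induction m with
  | zero => rfl
  | succ m ih => rw [Function.iterate_succ_apply', ih, lapl_polyFun, Function.iterate_succ_apply']

lemma pderiv_comm (i j : Fin n) (p : MvPolynomial (Fin n) ℝ) :
    pderiv i (pderiv j p) = pderiv j (pderiv i p) := by
  induction p using MvPolynomial.induction_on with
  | C a => simp
  | add p q hp hq => simp [hp, hq]
  | mul_X p k hp =>
    have hX : ∀ a b : Fin n, pderiv a (pderiv b (X k : MvPolynomial (Fin n) ℝ)) = 0 := by
      intro a b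
      rw [pderiv_X, Pi.single_apply]
      split_ifs <;> simp
    simp only [pderiv_mul, map_add, hp, hX]
    ring

lemma polyLap_pderiv (i : Fin n) (p : MvPolynomial (Fin n) ℝ) :
    polyLap n (pderiv i p) = pderiv i (polyLap n p) := by
  simp only [polyLap_apply, map_sum]
  refine Finset.sum_congr rfl fun k _ => ?_
  rw [pderiv_comm k i p, pderiv_comm k i]

lemma iterate_polyLap_pderiv (m : ℕ) (i : Fin n) (p : MvPolynomial (Fin n) ℝ) :
    (polyLap n)^[m] (pderiv i p) = pderiv i ((polyLap n)^[m] p) := by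
  induction m with
  | zero => rfl
  | succ m ih => rw [Function.iterate_succ_apply', ih, polyLap_pderiv, Function.iterate_succ_apply']

lemma polyLap_mul (p q : MvPolynomial (Fin n) ℝ) :
    polyLap n (p * q) =
      polyLap n p * q + 2 * ∑ k, pderiv k p * pderiv k q + p * polyLap n q := by
  simp only [polyLap_apply, pderiv_mul, map_add, Finset.sum_mul, Finset.mul_sum,
    ← Finset.sum_add_distrib]
  exact Finset.sum_congr rfl fun k _ => by ring

/-- The polynomial `u(|x|²)` in the coordinates of `x`. -/
def radial (n : ℕ) (u : Polynomial ℝ) : MvPolynomial (Fin n) ℝ :=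
  Polynomial.aeval (∑ i, X i ^ 2) u

lemma radial_add (u v : Polynomial ℝ) : radial n (u + v) = radial n u + radial n v :=
  map_add _ _ _

lemma radial_mul (u v : Polynomial ℝ) : radial n (u * v) = radial n u * radial n v :=
  map_mul _ _ _

lemma radial_natCast (c : ℕ) : radial n c = c := map_natCast _ _

lemma radial_X : radial n Polynomial.X = ∑ i, X i ^ 2 := by simp [radial]

lemma polyFun_radial (u : Polynomial ℝ) (x : EuclideanSpace ℝ (Fin n)) :
    polyFun (radial n u) x = u.eval (‖x‖ ^ 2) := by
  rw [EuclideanSpace.real_norm_sq_eq, polyFun, radial, ← coe_aeval_eq_eval, RingHom.coe_coe,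
    ← Polynomial.aeval_algHom_apply]
  simp [Polynomial.aeval_def, Polynomial.eval₂_eq_eval_map]

lemma pderiv_radial (i : Fin n) (u : Polynomial ℝ) :
    pderiv i (radial n u) = 2 * X i * radial n u.derivative := by
  have h : pderiv i (∑ k, X k ^ 2 : MvPolynomial (Fin n) ℝ) = 2 * X i := by
    simp [pderiv_X, Pi.single_apply]
  rw [radial, Derivation.map_aeval, h, smul_eq_mul, mul_comm, radial]

lemma polyLap_radial (u : Polynomial ℝ) :
    polyLap n (radial n u) =
      radial n (2 * (n : Polynomial ℝ) * u.derivative +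
        4 * Polynomial.X * u.derivative.derivative) := by
  have h2 : radial n 2 = 2 := by exact_mod_cast radial_natCast (n := n) 2
  have h4 : radial n 4 = 4 := by exact_mod_cast radial_natCast (n := n) 4
  have hterm : ∀ k : Fin n, pderiv k (pderiv k (radial n u)) =
      2 * radial n u.derivative + 4 * X k ^ 2 * radial n u.derivative.derivative := by
    intro k
    have hk : pderiv k (2 * X k : MvPolynomial (Fin n) ℝ) = 2 := by
      rw [two_mul, map_add, pderiv_X_self]; norm_num
    rw [pderiv_radial, pderiv_mul, hk, pderiv_radial]
    ring
  simp only [polyLap_apply, hterm, radial_add, radial_mul, radial_natCast, radial_X, h2, h4,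
    Finset.sum_add_distrib, Finset.mul_sum, Finset.sum_mul, Finset.sum_const, Finset.card_univ,
    Fintype.card_fin, nsmul_eq_mul]
  ring

lemma polyLap_radial_mul (u : Polynomial ℝ) {d : ℕ} {p : MvPolynomial (Fin n) ℝ}
    (hp : p.IsHomogeneous d) :
    polyLap n (radial n u * p) =
      radial n ((2 * (n : Polynomial ℝ) + 4 * (d : Polynomial ℝ)) * u.derivative +
        4 * Polynomial.X * u.derivative.derivative) * p + radial n u * polyLap n p := by
  have h2 : radial n 2 = 2 := by exact_mod_cast radial_natCast (n := n) 2
  have h4 : radial n 4 = 4 := by exact_mod_cast radial_natCast (n := n) 4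
  have hE : ∑ k, pderiv k (radial n u) * pderiv k p = 2 * d * radial n u.derivative * p := by
    calc ∑ k, pderiv k (radial n u) * pderiv k p
        = 2 * radial n u.derivative * ∑ k, X k * pderiv k p := by
          rw [Finset.mul_sum]
          exact Finset.sum_congr rfl fun k _ => by rw [pderiv_radial]; ring
      _ = _ := by rw [hp.sum_X_mul_pderiv, nsmul_eq_mul]; ring
  rw [polyLap_mul, hE, polyLap_radial]
  simp only [radial_add, radial_mul, radial_natCast, h2, h4]
  ring

lemma pderiv_pderiv_radial_mul (i j : Fin n) (u : Polynomial ℝ) (p : MvPolynomial (Fin n) ℝ) :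
    pderiv i (pderiv j (radial n u * p)) =
      2 * (if i = j then 1 else 0) * radial n u.derivative * p +
        4 * X i * X j * radial n u.derivative.derivative * p +
        2 * radial n u.derivative * (X i * pderiv j p + X j * pderiv i p) +
        radial n u * pderiv i (pderiv j p) := by
  have hX : pderiv i (2 * X j : MvPolynomial (Fin n) ℝ) = 2 * (if i = j then 1 else 0) := by
    rw [two_mul, map_add, pderiv_X, Pi.single_apply, ← two_mul]
    simp only [eq_comm]
  simp only [pderiv_mul, pderiv_radial, map_add, hX]
  ring

end PolynomialCalculus

section WeylPolynomials

open MvPolynomial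

variable {n : ℕ} (W : Fin n → Fin n → Fin n → Fin n → ℝ)

/-- The tensor `H` as a matrix of quadratic forms. -/
def polyH (p q : Fin n) : MvPolynomial (Fin n) ℝ :=
  ∑ k, ∑ l, C (W p k q l) * X k * X l

lemma polyFun_polyH (p q : Fin n) : polyFun (polyH W p q) = Hten n W p q := by
  ext x
  simp [polyFun, polyH, Hten]

lemma polyFun_radial_mul_polyH (f : Polynomial ℝ) (p q : Fin n) :
    polyFun (radial n f * polyH W p q) = hbar n W f p q := by
  ext x
  rw [hbar, ← polyFun_radial, ← polyFun_polyH]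
  simp [polyFun]

lemma isHomogeneous_polyH (p q : Fin n) : (polyH W p q).IsHomogeneous 2 := by
  refine IsHomogeneous.sum _ _ _ fun k _ => IsHomogeneous.sum _ _ _ fun l _ => ?_
  exact ((isHomogeneous_C _ _).mul (isHomogeneous_X ℝ k)).mul (isHomogeneous_X ℝ l)

lemma pderiv_polyH (j p q : Fin n) :
    pderiv j (polyH W p q) = ∑ l, C (W p j q l + W p l q j) * X l := by
  simp only [polyH, map_sum, pderiv_mul, pderiv_C, pderiv_X, Pi.single_apply, zero_mul, zero_add,
    mul_ite, ite_mul, mul_one, mul_zero, Finset.sum_add_distrib, C_add, add_mul]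
  congr 1
  · rw [Finset.sum_comm]; simp
  · simp

lemma pderiv_pderiv_polyH (i j p q : Fin n) :
    pderiv i (pderiv j (polyH W p q)) = C (W p i q j + W p j q i) := by
  rw [pderiv_polyH]
  simp only [map_sum, pderiv_C_mul, pderiv_X, Pi.single_apply, mul_ite, mul_one, mul_zero,
    Finset.sum_ite_eq', Finset.mem_univ, if_true]
  rw [add_comm]

/-- The polynomial `|H|²`. -/
def polyHsq : MvPolynomial (Fin n) ℝ := ∑ p, ∑ q, polyH W p q ^ 2

/-- The polynomial `|∂H|²`. -/
def polyDHsq : MvPolynomial (Fin n) ℝ := ∑ k, ∑ p, ∑ q, pderiv k (polyH W p q) ^ 2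

lemma sum_comm_cycle {ι M : Type*} [Fintype ι] [AddCommMonoid M] (F : ι → ι → ι → M) :
    ∑ k, ∑ p, ∑ q, F k p q = ∑ p, ∑ q, ∑ k, F k p q := by
  rw [Finset.sum_comm]
  exact Finset.sum_congr rfl fun p _ => Finset.sum_comm

lemma polyDHsq_eq_sum_comm : polyDHsq W = ∑ p, ∑ q, ∑ k, pderiv k (polyH W p q) ^ 2 :=
  sum_comm_cycle _

lemma isHomogeneous_polyHsq : (polyHsq W).IsHomogeneous 4 :=
  IsHomogeneous.sum _ _ _ fun p _ => IsHomogeneous.sum _ _ _ fun q _ =>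
    (isHomogeneous_polyH W p q).pow 2

lemma isHomogeneous_polyDHsq : (polyDHsq W).IsHomogeneous 2 :=
  IsHomogeneous.sum _ _ _ fun _ _ => IsHomogeneous.sum _ _ _ fun p _ =>
    IsHomogeneous.sum _ _ _ fun q _ => (isHomogeneous_polyH W p q).pderiv.pow 2

lemma polyLap_polyH (hanti1 : ∀ i j k l, W i j k l = -W j i k l)
    (hanti2 : ∀ i j k l, W i j k l = -W i j l k) (htrace : ∀ j k, ∑ i, W i j i k = 0)
    (p q : Fin n) : polyLap n (polyH W p q) = 0 := by
  have h : ∀ k, W p k q k + W p k q k = 2 * W k p k q := fun k => by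
    rw [hanti1 p k, hanti2 k p q k]; ring
  simp only [polyLap_apply, pderiv_pderiv_polyH, h, ← map_sum, ← Finset.mul_sum, htrace, mul_zero,
    map_zero]

lemma polyLap_polyHsq (hH : ∀ p q, polyLap n (polyH W p q) = 0) :
    polyLap n (polyHsq W) = 2 * polyDHsq W := by
  rw [polyDHsq_eq_sum_comm]
  simp only [polyHsq, map_sum, Finset.mul_sum]
  refine Finset.sum_congr rfl fun p _ => Finset.sum_congr rfl fun q _ => ?_
  rw [sq, polyLap_mul, hH, Finset.mul_sum, zero_mul, mul_zero, zero_add, add_zero]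
  exact Finset.sum_congr rfl fun k _ => by ring

lemma polyLap_polyDHsq : polyLap n (polyDHsq W) = 2 * C (normWsq n W) := by
  have hterm : ∀ k p q : Fin n, polyLap n (pderiv k (polyH W p q) ^ 2) =
      2 * C (∑ l, (W p k q l + W p l q k) ^ 2) := by
    intro k p q
    have h0 : polyLap n (pderiv k (polyH W p q)) = 0 := by
      simp [polyLap_apply, pderiv_pderiv_polyH]
    rw [sq, polyLap_mul, h0, zero_mul, mul_zero, zero_add, add_zero]
    simp only [pderiv_pderiv_polyH, map_sum, ← map_mul]
    congr 1
    exact Finset.sum_congr rfl fun l _ => by ring_nf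
  simp only [polyDHsq, map_sum, hterm, normWsq, Finset.mul_sum]
  exact sum_comm_cycle _

lemma pderiv_polyHsq (j : Fin n) :
    pderiv j (polyHsq W) = 2 * ∑ p, ∑ q, polyH W p q * pderiv j (polyH W p q) := by
  simp only [polyHsq, map_sum, Finset.mul_sum, pderiv_pow]
  refine Finset.sum_congr rfl fun p _ => Finset.sum_congr rfl fun q _ => ?_
  push_cast; ring

lemma pderiv_pderiv_polyHsq (i j : Fin n) :
    pderiv i (pderiv j (polyHsq W)) =
      2 * ∑ p, ∑ q, pderiv i (polyH W p q) * pderiv j (polyH W p q) +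
        2 * ∑ p, ∑ q, polyH W p q * pderiv i (pderiv j (polyH W p q)) := by
  rw [pderiv_polyHsq, two_mul, map_add, ← two_mul]
  simp only [map_sum, pderiv_mul, Finset.sum_add_distrib]
  ring

lemma pderiv_polyDHsq (j : Fin n) :
    pderiv j (polyDHsq W) =
      2 * ∑ k, ∑ p, ∑ q, pderiv k (polyH W p q) * pderiv j (pderiv k (polyH W p q)) := by
  simp only [polyDHsq, map_sum, Finset.mul_sum, pderiv_pow]
  refine Finset.sum_congr rfl fun k _ => Finset.sum_congr rfl fun p _ =>
    Finset.sum_congr rfl fun q _ => ?_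
  push_cast; ring

lemma pderiv_pderiv_polyDHsq (hanti1 : ∀ i j k l, W i j k l = -W j i k l)
    (hanti2 : ∀ i j k l, W i j k l = -W i j l k)
    (i j : Fin n) :
    pderiv i (pderiv j (polyDHsq W)) = 2 * C (Wtil n W i j) := by
  have hW : ∀ a k p q : Fin n, W p a q k + W p k q a = -(W a p q k + W p k a q) := by
    intro a k p q
    rw [hanti1 p a, hanti2 p k q a]; ring
  rw [pderiv_polyDHsq, two_mul, map_add, ← two_mul]
  congr 1
  simp only [map_sum, pderiv_mul, pderiv_pderiv_polyH, pderiv_C, mul_zero, add_zero, hW,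
    ← map_mul, neg_mul_neg, Wtil]
  exact sum_comm_cycle _

lemma sum_sq_pderiv_hbar (f : Polynomial ℝ) :
    ∑ k, ∑ p, ∑ q, pderiv k (radial n f * polyH W p q) ^ 2 =
      radial n (4 * Polynomial.X * f.derivative ^ 2 + 8 * f * f.derivative) * polyHsq W +
        radial n (f ^ 2) * polyDHsq W := by
  have h4 : radial n 4 = 4 := by exact_mod_cast radial_natCast (n := n) 4
  have h8 : radial n 8 = 8 := by exact_mod_cast radial_natCast (n := n) 8
  rw [sum_comm_cycle, polyHsq, polyDHsq_eq_sum_comm, Finset.mul_sum, Finset.mul_sum,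
    ← Finset.sum_add_distrib]
  refine Finset.sum_congr rfl fun p _ => ?_
  rw [Finset.mul_sum, Finset.mul_sum, ← Finset.sum_add_distrib]
  refine Finset.sum_congr rfl fun q _ => ?_
  have hterm : ∀ k : Fin n, pderiv k (radial n f * polyH W p q) ^ 2 =
      4 * radial n f.derivative ^ 2 * polyH W p q ^ 2 * X k ^ 2 +
        4 * radial n f * radial n f.derivative * polyH W p q * (X k * pderiv k (polyH W p q)) +
        radial n f ^ 2 * pderiv k (polyH W p q) ^ 2 := by
    intro k
    rw [pderiv_mul, pderiv_radial]
    ring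
  simp only [hterm, Finset.sum_add_distrib, ← Finset.mul_sum,
    (isHomogeneous_polyH W p q).sum_X_mul_pderiv, radial_add, radial_mul, radial_X, h4, h8, sq f,
    sq f.derivative, nsmul_eq_mul]
  push_cast
  ring

lemma exists_iterate_polyLap_eq (hH : ∀ p q, polyLap n (polyH W p q) = 0)
    (f : Polynomial ℝ) (m : ℕ) :
    ∃ a b c : Polynomial ℝ,
      (polyLap n)^[m] (∑ k, ∑ p, ∑ q, pderiv k (radial n f * polyH W p q) ^ 2) =
        radial n a * polyHsq W + radial n b * polyDHsq W + radial n c * C (normWsq n W) := by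
  have h2 : radial n 2 = 2 := by exact_mod_cast radial_natCast (n := n) 2
  induction m with
  | zero =>
    have h0 : radial n 0 = 0 := map_zero _
    exact ⟨4 * Polynomial.X * f.derivative ^ 2 + 8 * f * f.derivative, f ^ 2, 0, by
      rw [Function.iterate_zero_apply, sum_sq_pderiv_hbar W f, h0, zero_mul, add_zero]⟩
  | succ m ih =>
    obtain ⟨a, b, c, h⟩ := ih
    have hN : polyLap n (C (normWsq n W)) = 0 := by simp [polyLap_apply]
    rw [Function.iterate_succ_apply', h, map_add, map_add,
      polyLap_radial_mul a (isHomogeneous_polyHsq W),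
      polyLap_radial_mul b (isHomogeneous_polyDHsq W),
      polyLap_radial_mul c (isHomogeneous_C _ _), polyLap_polyHsq W hH, polyLap_polyDHsq, hN]
    refine ⟨(2 * (n : Polynomial ℝ) + 4 * ((4 : ℕ) : Polynomial ℝ)) * a.derivative +
        4 * Polynomial.X * a.derivative.derivative,
      (2 * (n : Polynomial ℝ) + 4 * ((2 : ℕ) : Polynomial ℝ)) * b.derivative +
        4 * Polynomial.X * b.derivative.derivative + 2 * a,
      (2 * (n : Polynomial ℝ) + 4 * ((0 : ℕ) : Polynomial ℝ)) * c.derivative +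
        4 * Polynomial.X * c.derivative.derivative + 2 * b,
      ?_⟩
    rw [radial_add _ (2 * a), radial_add _ (2 * b), radial_mul 2, radial_mul 2, h2]
    ring

end WeylPolynomials

theorem stmt_16 (n : ℕ) (hn : 2 ≤ n) (W4 : Fin n → Fin n → Fin n → Fin n → ℝ)
    (hanti1 : ∀ i j k l, W4 i j k l = -W4 j i k l)
    (hanti2 : ∀ i j k l, W4 i j k l = -W4 i j l k)
    (hsymm : ∀ i j k l, W4 i j k l = W4 k l i j)
    (hbianchi : ∀ i j k l, W4 i j k l + W4 i k l j + W4 i l j k = 0)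
    (htrace : ∀ j k, ∑ i, W4 i j i k = 0)
    (d₀ : ℕ) (hd₀ : 1 ≤ d₀ ∧ d₀ ≤ 4) (f : Polynomial ℝ) (hf : f.natDegree = d₀) :
    ∀ m : ℕ, m ≤ 2 * d₀ + 1 →
      ∃ G₁ G₂ G₃ G₄ G₅ G₆ G₇ G₈ G₉ G₁₀ G₁₁ : ℝ → ℝ,
        ∀ i j : Fin n, ∀ x : EuclideanSpace ℝ (Fin n),
          (∑ k, ∑ p, ∑ q,
              (lapl n)^[m]
                (pd n i (pd n j (fun y => (pd n k (hbar n W4 f p q) y) ^ 2))) x) =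
            G₁ ‖x‖ * (if i = j then 1 else 0) *
                (∑ k, ∑ p, ∑ q, (pd n k (Hten n W4 p q) x) ^ 2) +
              G₂ ‖x‖ * (if i = j then 1 else 0) * (∑ p, ∑ q, (Hten n W4 p q x) ^ 2) +
              G₃ ‖x‖ * (if i = j then 1 else 0) * normWsq n W4 +
              G₄ ‖x‖ * (∑ p, ∑ q,
                (x i * (Hten n W4 p q x * pd n j (Hten n W4 p q) x) +
                  x j * (Hten n W4 p q x * pd n i (Hten n W4 p q) x))) +
              G₅ ‖x‖ * (∑ p, ∑ q, pd n i (Hten n W4 p q) x * pd n j (Hten n W4 p q) x) +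
              G₆ ‖x‖ * (∑ k, ∑ p, ∑ q,
                (x i * (pd n k (Hten n W4 p q) x * pd n j (pd n k (Hten n W4 p q)) x) +
                  x j * (pd n k (Hten n W4 p q) x * pd n i (pd n k (Hten n W4 p q)) x))) +
              G₇ ‖x‖ * Wtil n W4 i j +
              G₈ ‖x‖ * (x i * x j) * (∑ k, ∑ p, ∑ q, (pd n k (Hten n W4 p q) x) ^ 2) +
              G₉ ‖x‖ * (x i * x j) * (∑ p, ∑ q, (Hten n W4 p q x) ^ 2) +
              G₁₀ ‖x‖ * (x i * x j) * normWsq n W4 +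
              G₁₁ ‖x‖ * (∑ p, ∑ q, Hten n W4 p q x * pd n i (pd n j (Hten n W4 p q)) x) := by
  have hH := polyLap_polyH W4 hanti1 hanti2 htrace
  intro m _
  obtain ⟨a, b, c, habc⟩ := exists_iterate_polyLap_eq W4 hH f m
  refine ⟨fun r => 2 * b.derivative.eval (r ^ 2), fun r => 2 * a.derivative.eval (r ^ 2),
    fun r => 2 * c.derivative.eval (r ^ 2), fun r => 4 * a.derivative.eval (r ^ 2),
    fun r => 2 * a.eval (r ^ 2), fun r => 4 * b.derivative.eval (r ^ 2),
    fun r => 2 * b.eval (r ^ 2), fun r => 4 * b.derivative.derivative.eval (r ^ 2),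
    fun r => 4 * a.derivative.derivative.eval (r ^ 2),
    fun r => 4 * c.derivative.derivative.eval (r ^ 2), fun r => 2 * a.eval (r ^ 2), ?_⟩
  intro i j x
  have hsq : ∀ k p q : Fin n, (fun y => (pd n k (hbar n W4 f p q) y) ^ 2) =
      polyFun (MvPolynomial.pderiv k (radial n f * polyH W4 p q) ^ 2) := by
    intro k p q
    ext y
    rw [← polyFun_radial_mul_polyH, pd_polyFun]
    simp [polyFun]
  have hlhs : (∑ k, ∑ p, ∑ q,
      (lapl n)^[m] (pd n i (pd n j (fun y => (pd n k (hbar n W4 f p q) y) ^ 2))) x) =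
      polyFun (MvPolynomial.pderiv i (MvPolynomial.pderiv j
        (radial n a * polyHsq W4 + radial n b * polyDHsq W4 +
          radial n c * MvPolynomial.C (normWsq n W4)))) x := by
    simp only [hsq, pd_polyFun, iterate_lapl_polyFun, iterate_polyLap_pderiv]
    rw [← habc]
    simp only [← Module.End.pow_apply, map_sum, polyFun]
  rw [hlhs]
  simp only [map_add, pderiv_pderiv_radial_mul, pderiv_pderiv_polyHsq,
    pderiv_pderiv_polyDHsq W4 hanti1 hanti2]
  simp only [pderiv_polyHsq, pderiv_polyDHsq,
    MvPolynomial.pderiv_C, map_zero, mul_zero, add_zero, ← polyFun_polyH, pd_polyFun,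
    ← polyFun_radial, Finset.sum_add_distrib, ← Finset.mul_sum]
  simp only [polyHsq, polyDHsq, polyFun, map_add, map_mul, map_sum, map_pow, MvPolynomial.eval_X,
    MvPolynomial.eval_C, map_ofNat, apply_ite (MvPolynomial.eval _), map_one, map_zero]
  ring
end
end
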